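/- arXiv:1711.02139 — 2 statements merged into one kernel-verified Lean document; each statement's English description precedes it below -/
import Mathlib

section
/- Let p = q = 2k be even, n = 2q, F a field of characteristic zero, J_q the q×q antidiagonal identity, J_{q,q} = diag(J_q, −J_q), 𝔤 = 𝔬(J_{q,q}), and 𝔤(−1) the −1 eigenspace of conjugation by I_{q,q}. Let e* = [[ε_k, λ_{k,k}],[0_k, 1_k]] (where ε_k is the k×k superdiagonal shift and λ_{k,k} has a single 1 in the bottom-left corner), and e = [[0, e*],[J_q (e*)ᵗ J_q, 0]]. Then e ∈ 𝔤(−1), e is nilpotent, and dim_F {X ∈ 𝔤(−1) : [e,X] = 0} = 2k. -/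
open Matrix

namespace OrthSplit

variable {F : Type*} [Field F]

/-- antidiagonal identity -/
def Jm (F : Type*) [Field F] (q : ℕ) : Matrix (Fin q) (Fin q) F :=
  fun i j => if (i : ℕ) + (j : ℕ) + 1 = q then 1 else 0

/-- the matrix `e*` -/
def Am (F : Type*) [Field F] (k q : ℕ) : Matrix (Fin q) (Fin q) F := fun i j =>
      if (i : ℕ) < k then (if (j : ℕ) = (i : ℕ) + 1 then 1 else 0)
      else (if (j : ℕ) = (i : ℕ) then 1 else 0)

/-- the persymmetric transpose -/
def sg {q : ℕ} (X : Matrix (Fin q) (Fin q) F) : Matrix (Fin q) (Fin q) F :=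
  Jm F q * Xᵀ * Jm F q

lemma Jm_apply (q : ℕ) (i j : Fin q) : Jm F q i j = if j = i.rev then 1 else 0 := by
  unfold Jm
  congr 1
  simp only [Fin.ext_iff, Fin.val_rev, eq_iff_iff]
  omega

lemma Jm_apply' (q : ℕ) (i j : Fin q) : Jm F q i j = if i = j.rev then 1 else 0 := by
  unfold Jm
  congr 1
  simp only [Fin.ext_iff, Fin.val_rev, eq_iff_iff]
  omega

lemma Jm_mul {q : ℕ} (X : Matrix (Fin q) (Fin q) F) (i j : Fin q) :
    (Jm F q * X) i j = X i.rev j := by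
  simp [Matrix.mul_apply, Jm_apply]

lemma mul_Jm {q : ℕ} (X : Matrix (Fin q) (Fin q) F) (i j : Fin q) :
    (X * Jm F q) i j = X i j.rev := by
  simp [Matrix.mul_apply, Jm_apply']

lemma sg_apply {q : ℕ} (X : Matrix (Fin q) (Fin q) F) (i j : Fin q) :
    sg X i j = X j.rev i.rev := by
  simp [sg, mul_Jm, Jm_mul]

lemma Jm_sq (q : ℕ) : Jm F q * Jm F q = 1 := by
  ext i j
  rw [mul_Jm, Jm_apply, Matrix.one_apply]
  simp [eq_comm]

lemma Jm_tr (q : ℕ) : (Jm F q)ᵀ = Jm F q := by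
  ext i j
  rw [Matrix.transpose_apply, Jm_apply, Jm_apply']

lemma sg_sg {q : ℕ} (X : Matrix (Fin q) (Fin q) F) : sg (sg X) = X := by
  ext i j
  simp [sg_apply]

lemma sg_mul {q : ℕ} (X Y : Matrix (Fin q) (Fin q) F) : sg (X * Y) = sg Y * sg X := by
  unfold sg
  rw [Matrix.transpose_mul]
  calc _ = Jm F q * Yᵀ * 1 * Xᵀ * Jm F q := by simp [Matrix.mul_assoc]
    _ = _ := by rw [← Jm_sq]; simp only [Matrix.mul_assoc]

/-- `B = J (e*)ᵀ J` -/
abbrev Bm (F : Type*) [Field F] (k q : ℕ) : Matrix (Fin q) (Fin q) F := sg (Am F k q)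

/-- `N = B A`. -/
abbrev Nm (F : Type*) [Field F] (k q : ℕ) : Matrix (Fin q) (Fin q) F := Bm F k q * Am F k q

lemma sg_Nm (k q : ℕ) : sg (Nm F k q) = Nm F k q := by
  rw [sg_mul, sg_sg]

lemma sg_Nm_pow (k q j : ℕ) : sg (Nm F k q ^ j) = Nm F k q ^ j := by
  induction j with
  | zero => simp [sg, Jm_sq]
  | succ j ih => rw [pow_succ, sg_mul, ih, sg_Nm, ← pow_succ', ← pow_succ]

/-- rows of `A X` -/
lemma Am_mul {k q : ℕ} (X : Matrix (Fin q) (Fin q) F) (i a j : Fin q)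
    (h : (a : ℕ) = if (i : ℕ) < k then (i : ℕ) + 1 else i) :
    (Am F k q * X) i j = X a j := by
  rw [Matrix.mul_apply, Finset.sum_eq_single a]
  · have : Am F k q i a = 1 := by
      unfold Am; split_ifs at h ⊢ <;> first | rfl | omega
    rw [this, one_mul]
  · intro b _ hb
    have hb' : (b : ℕ) ≠ a := fun h => hb (Fin.ext h)
    have : Am F k q i b = 0 := by
      unfold Am; split_ifs at h ⊢ <;> first | rfl | omega
    rw [this, zero_mul]
  · simp

lemma Bm_apply {k q : ℕ} (hq : q = 2 * k) (i j : Fin q) :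
    Bm F k q i j = if (j : ℕ) < k then (if (i : ℕ) = j then 1 else 0)
      else (if (i : ℕ) + 1 = j then 1 else 0) := by
  rw [show Bm F k q i j = _ from sg_apply _ i j]
  unfold Am
  simp only [Fin.val_rev]
  have := i.2
  have := j.2
  split_ifs <;> first | rfl | omega

/-- columns of `X B` -/
lemma mul_Bm {k q : ℕ} (_hk : 0 < k) (hq : q = 2 * k) (X : Matrix (Fin q) (Fin q) F)
    (i a j : Fin q) (h : (a : ℕ) = if (j : ℕ) < k then (j : ℕ) else j - 1) :
    (X * Bm F k q) i j = X i a := by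
  rw [Matrix.mul_apply, Finset.sum_eq_single a]
  · have : Bm F k q a j = 1 := by
      rw [Bm_apply hq]; split_ifs at h ⊢ <;> first | rfl | omega
    rw [this, mul_one]
  · intro b _ hb
    have hb' : (b : ℕ) ≠ a := fun h => hb (Fin.ext h)
    have : Bm F k q b j = 0 := by
      rw [Bm_apply hq]; split_ifs at h ⊢ <;> first | rfl | omega
    rw [this, mul_zero]
  · simp

/-- rows of `B X` -/
lemma Bm_mul_lt {k q : ℕ} (hq : q = 2 * k) (X : Matrix (Fin q) (Fin q) F)
    (i j : Fin q) (h : (i : ℕ) + 1 < k) :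
    (Bm F k q * X) i j = X i j := by
  rw [Matrix.mul_apply, Finset.sum_eq_single i]
  · rw [Bm_apply hq, if_pos (by omega), if_pos rfl, one_mul]
  · intro b _ hb
    have hb' : (b : ℕ) ≠ i := fun h => hb (Fin.ext h)
    have : Bm F k q i b = 0 := by
      rw [Bm_apply hq]; split_ifs <;> first | rfl | omega
    rw [this, zero_mul]
  · simp

lemma Bm_mul_gt {k q : ℕ} (hq : q = 2 * k) (X : Matrix (Fin q) (Fin q) F)
    (i a j : Fin q) (h : k ≤ (i : ℕ)) (ha : (a : ℕ) = i + 1) :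
    (Bm F k q * X) i j = X a j := by
  rw [Matrix.mul_apply, Finset.sum_eq_single a]
  · rw [Bm_apply hq, if_neg (by omega), if_pos ha.symm, one_mul]
  · intro b _ hb
    have hb' : (b : ℕ) ≠ a := fun h => hb (Fin.ext h)
    have : Bm F k q i b = 0 := by
      rw [Bm_apply hq]; split_ifs <;> first | rfl | omega
    rw [this, zero_mul]
  · simp

lemma Bm_mul_last {k q : ℕ} (hq : q = 2 * k) (X : Matrix (Fin q) (Fin q) F)
    (i j : Fin q) (_hk : 0 < k) (h : (i : ℕ) + 1 = q) :
    (Bm F k q * X) i j = 0 := by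
  rw [Matrix.mul_apply]
  refine Finset.sum_eq_zero fun b _ => ?_
  have : Bm F k q i b = 0 := by
    rw [Bm_apply hq]; split_ifs <;> first | rfl | omega
  rw [this, zero_mul]

lemma Bm_mul_mid {k q : ℕ} (hq : q = 2 * k) (X : Matrix (Fin q) (Fin q) F)
    (i a j : Fin q) (h : (i : ℕ) + 1 = k) (ha : (a : ℕ) = k) :
    (Bm F k q * X) i j = X i j + X a j := by
  have hia : i ≠ a := by rintro rfl; omega
  rw [Matrix.mul_apply, Finset.sum_eq_add i a hia]
  · rw [Bm_apply hq, Bm_apply hq, if_pos (by omega), if_pos rfl, if_neg (by omega),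
      if_pos (by omega), one_mul, one_mul]
  · intro b _ hb
    have hb1 : (b : ℕ) ≠ i := fun h => hb.1 (Fin.ext h)
    have hb2 : (b : ℕ) ≠ a := fun h => hb.2 (Fin.ext h)
    have : Bm F k q i b = 0 := by
      rw [Bm_apply hq]; split_ifs <;> first | rfl | omega
    rw [this, zero_mul]
  · simp
  · simp

lemma Nm_apply {k q : ℕ} (hk : 0 < k) (hq : q = 2 * k) (i j : Fin q) :
    Nm F k q i j = if (j : ℕ) = i + 1 then (if (j : ℕ) = k then 2 else 1) else 0 := by
  have hi := i.2
  have hj := j.2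
  rcases lt_trichotomy ((i : ℕ) + 1) k with h | h | h
  · rw [Nm, Bm_mul_lt hq _ _ _ h]
    unfold Am
    split_ifs <;> first | rfl | omega
  · rw [Nm, Bm_mul_mid hq _ i ⟨k, by omega⟩ j h rfl]
    unfold Am
    simp only
    split_ifs <;> first | omega | norm_num
  · by_cases h2 : (i : ℕ) + 1 = q
    · rw [Nm, Bm_mul_last hq _ i j hk h2, if_neg (by omega)]
    · rw [Nm, Bm_mul_gt hq _ i ⟨i + 1, by omega⟩ j (by omega) rfl]
      unfold Am
      simp only
      split_ifs <;> first | rfl | omega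

lemma mul_Nm {k q : ℕ} (hk : 0 < k) (hq : q = 2 * k) (X : Matrix (Fin q) (Fin q) F)
    (i a j : Fin q) (h : (j : ℕ) = a + 1) :
    (X * Nm F k q) i j = X i a * (if (j : ℕ) = k then 2 else 1) := by
  rw [Matrix.mul_apply, Finset.sum_eq_single a]
  · rw [Nm_apply hk hq, if_pos h]
  · intro b _ hb
    have hb' : (b : ℕ) ≠ a := fun h => hb (Fin.ext h)
    rw [Nm_apply hk hq, if_neg (by omega), mul_zero]
  · simp

lemma Nm_pow_zero {k q : ℕ} (hk : 0 < k) (hq : q = 2 * k) (m : ℕ) (i j : Fin q)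
    (h : (j : ℕ) < i + m) : (Nm F k q ^ m) i j = 0 := by
  induction m generalizing j with
  | zero => simp; rw [Matrix.one_apply_ne]; rintro rfl; omega
  | succ m ih =>
    rw [pow_succ, Matrix.mul_apply]
    refine Finset.sum_eq_zero fun b _ => ?_
    by_cases hb : (j : ℕ) = b + 1
    · rw [ih b (by omega), zero_mul]
    · rw [Nm_apply hk hq, if_neg hb, mul_zero]

lemma Nm_nil {k q : ℕ} (hk : 0 < k) (hq : q = 2 * k) : Nm F k q ^ q = 0 := by
  ext i j
  exact Nm_pow_zero hk hq q i j (by omega)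

lemma Nm_pow_mid {k q : ℕ} (m : ℕ) : (Am F k q * Bm F k q) ^ (m + 1)
    = Am F k q * Nm F k q ^ m * Bm F k q := by
  induction m with
  | zero => simp
  | succ m ih => rw [pow_succ, ih, pow_succ (Nm F k q)]; simp only [Matrix.mul_assoc]

lemma e_nil {k q : ℕ} (hk : 0 < k) (hq : q = 2 * k) :
    IsNilpotent (Matrix.fromBlocks 0 (Am F k q) (Bm F k q) 0) := by
  refine ⟨2 * (q + 1), ?_⟩
  rw [pow_mul, sq, Matrix.fromBlocks_multiply]
  simp only [Matrix.zero_mul, Matrix.mul_zero, zero_add, add_zero]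
  rw [Matrix.fromBlocks_diagonal_pow, Nm_pow_mid, Nm_nil hk hq, pow_succ,  Nm_nil hk hq]
  simp

/-- solutions -/
def Sol (k q : ℕ) (X : Matrix (Fin q) (Fin q) F) : Prop :=
  Am F k q * sg X = X * Bm F k q ∧ Bm F k q * X = sg X * Am F k q

lemma Sol_pow (k q j : ℕ) : Sol k q (Am F k q * Nm F k q ^ j) := by
  unfold Sol
  rw [sg_mul, sg_Nm_pow]
  refine ⟨by simp only [Matrix.mul_assoc], ?_⟩
  rw [← Matrix.mul_assoc, ← pow_succ', Matrix.mul_assoc, ← pow_succ]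

/-- the extra solution -/
def X0 (F : Type*) [Field F] (k q : ℕ) : Matrix (Fin q) (Fin q) F :=
  fun i j => if (j : ℕ) + 1 = q then
    (if (i : ℕ) = k then 1 else if (i : ℕ) + 1 = k then -1 else 0) else 0

lemma Sol_X0 {k q : ℕ} (hk : 0 < k) (hq : q = 2 * k) : Sol k q (X0 F k q) := by
  have hB : Bm F k q * X0 F k q = 0 := by
    ext i j
    have hi := i.2
    rw [Matrix.zero_apply]
    rcases lt_trichotomy ((i : ℕ) + 1) k with h | h | h
    · rw [Bm_mul_lt hq _ _ _ h]
      unfold X0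
      split_ifs <;> first | rfl | omega
    · rw [Bm_mul_mid hq _ i ⟨k, by omega⟩ j h rfl]
      unfold X0
      simp only
      split_ifs <;> first | omega | norm_num
    · by_cases h2 : (i : ℕ) + 1 = q
      · rw [Bm_mul_last hq _ i j hk h2]
      · rw [Bm_mul_gt hq _ i ⟨i + 1, by omega⟩ j (by omega) rfl]
        unfold X0
        simp only
        split_ifs <;> first | rfl | omega
  have hX : X0 F k q * Bm F k q = 0 := by
    ext i j
    have hj := j.2
    rw [mul_Bm hk hq _ i ⟨if (j : ℕ) < k then (j : ℕ) else j - 1, by split_ifs <;> omega⟩ j rfl]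
    unfold X0
    rw [if_neg]
    · rfl
    · simp only; split_ifs <;> omega
  constructor
  · have := congrArg sg hX
    rw [sg_mul, sg_sg] at this
    rw [hX, this]
    simp [sg]
  · have := congrArg sg hB
    rw [sg_mul, sg_sg] at this
    rw [hB, this]
    simp [sg]

lemma Sol_inj [CharZero F] {k q : ℕ} (hk : 0 < k) (hq : q = 2 * k)
    (X : Matrix (Fin q) (Fin q) F) (hX : Sol k q X)
    (h0 : ∀ i j : Fin q, (j : ℕ) + 1 = q → X i j = 0) : X = 0 := by
  obtain ⟨h1, h2⟩ := hX
  have hcomm : Nm F k q * (Bm F k q * X) = (Bm F k q * X) * Nm F k q := by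
    calc Nm F k q * (Bm F k q * X) = Bm F k q * (Am F k q * (Bm F k q * X)) := by
          simp only [Matrix.mul_assoc]
      _ = Bm F k q * (Am F k q * sg X) * Am F k q := by rw [h2]; simp only [Matrix.mul_assoc]
      _ = _ := by rw [h1]; simp only [Matrix.mul_assoc]
  have hM : ∀ m : ℕ, ∀ i j : Fin q, (j : ℕ) + 1 + m = q → (Bm F k q * X) i j = 0 := by
    intro m
    induction m with
    | zero =>
      intro i j hj
      rw [Matrix.mul_apply]
      exact Finset.sum_eq_zero fun b _ => by rw [h0 b j hj, mul_zero]
    | succ m ih =>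
      intro i j hj
      have e1 := mul_Nm hk hq (Bm F k q * X) i j ⟨j + 1, by omega⟩ rfl
      rw [← hcomm, Matrix.mul_apply, Finset.sum_eq_zero] at e1
      · have : (if (j : ℕ) + 1 = k then (2 : F) else 1) ≠ 0 := by split_ifs <;> norm_num
        exact (mul_eq_zero.mp e1.symm).resolve_right this
      · intro b _
        rw [ih b _ (by simp only; omega), mul_zero]
  have hBX : Bm F k q * X = 0 := by
    ext i j
    exact hM (q - 1 - j) i j (by omega)
  have hsymm : ∀ i j, (X * Bm F k q) i j = (X * Bm F k q) j.rev i.rev := by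
    intro i j
    rw [← sg_apply (X * Bm F k q) i j, sg_mul, sg_sg, h1]
  have hkq : k < q := by omega
  have hrow : ∀ i j : Fin q, (i : ℕ) ≠ k → (i : ℕ) + 1 ≠ k → X i j = 0 := by
    intro i j hi hi'
    rcases lt_or_ge ((i : ℕ)) k with h | h
    · rw [← Bm_mul_lt hq X i j (by omega), hBX, Matrix.zero_apply]
    · rw [← Bm_mul_gt hq X ⟨i - 1, by omega⟩ i j (by simp only; omega) (by simp only; omega),
        hBX, Matrix.zero_apply]
  have hrow2 : ∀ i a j : Fin q, (i : ℕ) + 1 = k → (a : ℕ) = k → X i j = - X a j := by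
    intro i a j hi ha
    have := Bm_mul_mid hq X i a j hi ha
    rw [hBX, Matrix.zero_apply] at this
    exact eq_neg_of_add_eq_zero_left this.symm
  have hk0 : ∀ a j : Fin q, (a : ℕ) = k → X a j = 0 := by
    intro a j ha
    have hj := j.2
    by_cases hl : (j : ℕ) + 1 = q
    · exact h0 a j hl
    by_cases hm : (j : ℕ) + 1 = k
    · have e := hsymm a a
      rw [mul_Bm hk hq X a j a (by split_ifs <;> omega),
        mul_Bm hk hq X a.rev j a.rev (by simp only [Fin.val_rev]; split_ifs <;> omega),
        hrow2 a.rev a j (by simp only [Fin.val_rev]; omega) ha] at e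
      exact self_eq_neg.mp e
    · obtain ⟨b, hb, hb1, hb2⟩ : ∃ b : Fin q, (j : ℕ) = (if (b : ℕ) < k then (b : ℕ) else b - 1) ∧
          (b : ℕ) ≠ k ∧ (b : ℕ) + 1 ≠ k := by
        by_cases hjk : (j : ℕ) < k
        · exact ⟨j, by rw [if_pos hjk], by omega, by omega⟩
        · exact ⟨⟨j + 1, by omega⟩, by rw [if_neg (by simp only; omega)]; simp,
            by simp only; omega, by simp only; omega⟩
      have e := hsymm a b
      rw [mul_Bm hk hq X a j b hb] at e
      rw [e, Matrix.mul_apply]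
      refine Finset.sum_eq_zero fun c _ => ?_
      rw [hrow, zero_mul] <;> simp only [Fin.val_rev] <;> omega
  ext i j
  rw [Matrix.zero_apply]
  by_cases hi : (i : ℕ) = k
  · exact hk0 i j hi
  by_cases hi' : (i : ℕ) + 1 = k
  · rw [hrow2 i ⟨k, hkq⟩ j hi' rfl, hk0 _ _ rfl, neg_zero]
  · exact hrow i j hi hi'

lemma Nm_pow_col [CharZero F] {k q : ℕ} (hk : 0 < k) (hq : q = 2 * k) (l : Fin q)
    (hl : (l : ℕ) + 1 = q) (j : ℕ) : ∀ m : Fin q, (m : ℕ) + 1 + j = q →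
    ∃ c : F, c ≠ 0 ∧ ∀ i, (Nm F k q ^ j) i l = if i = m then c else 0 := by
  induction j with
  | zero =>
    intro m hm
    have : m = l := Fin.ext (by omega)
    subst this
    exact ⟨1, one_ne_zero, fun i => by rw [pow_zero, Matrix.one_apply]⟩
  | succ j ih =>
    intro m hm
    obtain ⟨c, hc, h⟩ := ih ⟨m + 1, by omega⟩ (by simp only; omega)
    refine ⟨(if (m : ℕ) + 1 = k then 2 else 1) * c, ?_, fun i => ?_⟩
    · refine mul_ne_zero ?_ hc
      split_ifs <;> norm_num
    · rw [pow_succ', Matrix.mul_apply, Finset.sum_eq_single ⟨m + 1, by omega⟩]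
      · rw [h, if_pos rfl, Nm_apply hk hq]
        simp only [Nat.add_right_cancel_iff]
        by_cases him : i = m
        · rw [if_pos him, if_pos (by rw [him])]
        · rw [if_neg him, if_neg (fun h => him (Fin.ext h.symm)), zero_mul]
      · intro b _ hb
        rw [h, if_neg hb, mul_zero]
      · simp

lemma range_top [CharZero F] {k q : ℕ} (hk : 0 < k) (hq : q = 2 * k) (l : Fin q)
    (hl : (l : ℕ) + 1 = q) (R : Submodule F (Fin q → F))
    (hR : ∀ X : Matrix (Fin q) (Fin q) F, Sol k q X → (fun i => X i l) ∈ R) : R = ⊤ := by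
  have hkq : k < q := by omega
  have hA : ∀ m : Fin q, (fun i => Am F k q i m) ∈ R := by
    intro m
    have hm := m.2
    obtain ⟨c, hc, h⟩ := Nm_pow_col (F := F) hk hq l hl (q - 1 - m) m (by omega)
    have h1 := R.smul_mem c⁻¹ (hR _ (Sol_pow k q (q - 1 - m)))
    convert h1 using 1
    ext i
    rw [Pi.smul_apply, Matrix.mul_apply, Finset.sum_eq_single m]
    · rw [h, if_pos rfl, smul_eq_mul, mul_comm, mul_assoc, mul_inv_cancel₀ hc, mul_one]
    · intro b _ hb
      rw [h, if_neg hb, mul_zero]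
    · simp
  have hX0 := hR _ (Sol_X0 hk hq)
  have hk1 : (Pi.single ⟨k, hkq⟩ 1 : Fin q → F) ∈ R := by
    have h1 := R.smul_mem (2⁻¹ : F) (R.add_mem (hA ⟨k, hkq⟩) hX0)
    convert h1 using 1
    ext i
    simp only [Pi.smul_apply, Pi.add_apply, smul_eq_mul, Pi.single_apply, Fin.ext_iff, Am, X0]
    split_ifs <;> first | omega | norm_num
  have hs : ∀ i : Fin q, (Pi.single i 1 : Fin q → F) ∈ R := by
    intro i
    have hi := i.2
    rcases lt_trichotomy (i : ℕ) k with h | h | h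
    · by_cases h' : (i : ℕ) + 1 = k
      · have h1 := R.sub_mem (hA ⟨k, hkq⟩) hk1
        convert h1 using 1
        ext a
        simp only [Pi.sub_apply, Pi.single_apply, Fin.ext_iff, Am]
        split_ifs <;> first | omega | norm_num
      · convert hA ⟨i + 1, by omega⟩ using 1
        ext a
        simp only [Pi.single_apply, Fin.ext_iff, Am]
        split_ifs <;> first | omega | rfl
    · have : i = ⟨k, hkq⟩ := Fin.ext h
      rw [this]; exact hk1
    · convert hA i using 1
      ext a
      simp only [Pi.single_apply, Fin.ext_iff, Am]
      split_ifs <;> first | omega | rfl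
  rw [eq_top_iff]
  intro v _
  rw [pi_eq_sum_univ' v]
  exact R.sum_mem fun i _ => R.smul_mem _ (hs i)

lemma e_orth {q : ℕ} (X : Matrix (Fin q) (Fin q) F) :
    (Matrix.fromBlocks 0 X (sg X) 0)ᵀ * Matrix.fromBlocks (Jm F q) 0 0 (-Jm F q) +
      Matrix.fromBlocks (Jm F q) 0 0 (-Jm F q) * Matrix.fromBlocks 0 X (sg X) 0 = 0 := by
  have h1 : (sg X)ᵀ * Jm F q = Jm F q * X := by
    unfold sg
    simp only [Matrix.transpose_mul, Jm_tr, Matrix.transpose_transpose, Matrix.mul_assoc, Jm_sq,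
      Matrix.mul_one]
  have h2 : Jm F q * sg X = Xᵀ * Jm F q := by
    unfold sg
    simp only [← Matrix.mul_assoc, Jm_sq, Matrix.one_mul]
  rw [Matrix.fromBlocks_transpose, Matrix.fromBlocks_multiply, Matrix.fromBlocks_multiply,
    Matrix.fromBlocks_add]
  simp [h1, h2]

lemma e_theta {q : ℕ} (X Y : Matrix (Fin q) (Fin q) F) :
    (Matrix.fromBlocks 1 0 0 (-1) : Matrix (Fin q ⊕ Fin q) (Fin q ⊕ Fin q) F) *
      (Matrix.fromBlocks 0 X Y 0 * Matrix.fromBlocks 1 0 0 (-1)) =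
      - Matrix.fromBlocks 0 X Y 0 := by
  rw [Matrix.fromBlocks_multiply, Matrix.fromBlocks_multiply, Matrix.fromBlocks_neg]
  simp

lemma e_comm {k q : ℕ} (X : Matrix (Fin q) (Fin q) F) :
    Matrix.fromBlocks 0 (Am F k q) (Bm F k q) 0 * Matrix.fromBlocks 0 X (sg X) 0 -
      Matrix.fromBlocks 0 X (sg X) 0 * Matrix.fromBlocks 0 (Am F k q) (Bm F k q) 0 = 0 ↔
    Sol k q X := by
  rw [sub_eq_zero, Matrix.fromBlocks_multiply, Matrix.fromBlocks_multiply,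
    Matrix.fromBlocks_inj]
  simp [Sol]

lemma form_of [CharZero F] {q : ℕ} (Z : Matrix (Fin q ⊕ Fin q) (Fin q ⊕ Fin q) F)
    (h1 : Zᵀ * Matrix.fromBlocks (Jm F q) 0 0 (-Jm F q) +
      Matrix.fromBlocks (Jm F q) 0 0 (-Jm F q) * Z = 0)
    (h2 : (Matrix.fromBlocks 1 0 0 (-1) : Matrix (Fin q ⊕ Fin q) (Fin q ⊕ Fin q) F) *
      (Z * Matrix.fromBlocks 1 0 0 (-1)) = - Z) :
    Z = Matrix.fromBlocks 0 Z.toBlocks₁₂ (sg Z.toBlocks₁₂) 0 := by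
  obtain ⟨P, X, Y, R, rfl⟩ : ∃ P X Y R, Z = Matrix.fromBlocks P X Y R :=
    ⟨_, _, _, _, (Matrix.fromBlocks_toBlocks Z).symm⟩
  rw [Matrix.fromBlocks_multiply, Matrix.fromBlocks_multiply, Matrix.fromBlocks_neg,
    Matrix.fromBlocks_inj] at h2
  rw [Matrix.fromBlocks_transpose, Matrix.fromBlocks_multiply, Matrix.fromBlocks_multiply,
    Matrix.fromBlocks_add, ← Matrix.fromBlocks_zero, Matrix.fromBlocks_inj] at h1
  simp at h1 h2
  obtain ⟨hP, hR⟩ := h2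
  have hP : P = 0 := by
    ext i j
    exact self_eq_neg.mp (congrFun (congrFun hP i) j)
  have hR : R = 0 := by
    ext i j
    exact self_eq_neg.mp (congrFun (congrFun hR i) j)
  have hY : Y = sg X := by
    have h : Xᵀ * Jm F q = Jm F q * Y := by
      have := h1.2.2.1
      first
        | exact eq_of_sub_eq_zero (by rw [sub_eq_add_neg]; exact this)
        | exact add_neg_eq_zero.mp this
        | exact this
    unfold sg
    rw [Matrix.mul_assoc, h, ← Matrix.mul_assoc, Jm_sq, Matrix.one_mul]
  rw [Matrix.toBlocks_fromBlocks₁₂, hP, hR, hY]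

end OrthSplit



/-- for p = q = 2k, the element e = [[0, e*], [J_q (e*)ᵀ J_q, 0]]
(with e* the matrix obtained from the identity by shifting the first k diagonal
entries one column to the right) lies in 𝔤(−1) for 𝔤 = 𝔬(J_{q,q}), is nilpotent,
and its centralizer in 𝔤(−1) has dimension 2k. -/
theorem orthogonal_even_split_centralizer
    (F : Type*) [Field F] [CharZero F] (k q : ℕ) (hk : 0 < k) (hq : q = 2 * k) :
    let n := Fin q ⊕ Fin q
    let Jq : Matrix (Fin q) (Fin q) F := fun i j => if (i : ℕ) + (j : ℕ) + 1 = q then 1 else 0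
    let Jqq : Matrix n n F := Matrix.fromBlocks Jq 0 0 (-Jq)
    let Iqq : Matrix n n F := Matrix.fromBlocks 1 0 0 (-1)
    let estar : Matrix (Fin q) (Fin q) F := fun i j =>
      if (i : ℕ) < k then (if (j : ℕ) = (i : ℕ) + 1 then 1 else 0)
      else (if (j : ℕ) = (i : ℕ) then 1 else 0)
    let e : Matrix n n F := Matrix.fromBlocks 0 estar (Jq * estarᵀ * Jq) 0
    let orth : Matrix n n F →ₗ[F] Matrix n n F :=
      (LinearMap.mulRight F Jqq).comp
        (Matrix.transposeLinearEquiv n n F F).toLinearMap + LinearMap.mulLeft F Jqq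
    let θ : Module.End F (Matrix n n F) :=
      (LinearMap.mulLeft F Iqq).comp (LinearMap.mulRight F Iqq)
    let ade : Module.End F (Matrix n n F) :=
      LinearMap.mulLeft F e - LinearMap.mulRight F e
    (eᵀ * Jqq + Jqq * e = 0) ∧ (Iqq * e * Iqq = -e) ∧ IsNilpotent e ∧
    Module.finrank F
      ↥(LinearMap.ker orth ⊓ Module.End.eigenspace θ (-1) ⊓ LinearMap.ker ade) = 2 * k := by
  intro n Jq Jqq Iqq estar e orth θ ade
  have he1 : eᵀ * Jqq + Jqq * e = 0 := OrthSplit.e_orth (OrthSplit.Am F k q)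
  have he2 : Iqq * (e * Iqq) = -e :=
    OrthSplit.e_theta (OrthSplit.Am F k q) (OrthSplit.Bm F k q)
  refine ⟨he1, by rw [Matrix.mul_assoc]; exact he2, OrthSplit.e_nil hk hq, ?_⟩
  have hmem : ∀ Z : Matrix n n F,
      Z ∈ LinearMap.ker orth ⊓ Module.End.eigenspace θ (-1) ⊓ LinearMap.ker ade ↔
      (Zᵀ * Jqq + Jqq * Z = 0 ∧ Iqq * (Z * Iqq) = -Z) ∧ e * Z - Z * e = 0 := by
    intro Z
    rw [Submodule.mem_inf, Submodule.mem_inf, LinearMap.mem_ker, LinearMap.mem_ker,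
      Module.End.mem_eigenspace_iff, neg_one_smul]
    rfl
  generalize LinearMap.ker orth ⊓ Module.End.eigenspace θ (-1) ⊓ LinearMap.ker ade = S at hmem ⊢
  let l : Fin q := ⟨q - 1, by omega⟩
  have hl : (l : ℕ) + 1 = q := by simp only [l]; omega
  let L : Matrix n n F →ₗ[F] (Fin q → F) :=
    { toFun := fun Z i => Z (Sum.inl i) (Sum.inr l)
      map_add' := fun _ _ => rfl
      map_smul' := fun _ _ => rfl }
  have hinj : Function.Injective (L.domRestrict S) := by
    rw [← LinearMap.ker_eq_bot, LinearMap.ker_eq_bot']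
    rintro ⟨Z, hZ⟩ h0
    obtain ⟨⟨h1, h2⟩, h3⟩ := (hmem Z).1 hZ
    have hf := OrthSplit.form_of Z h1 h2
    rw [hf] at h3
    have hs := (OrthSplit.e_comm (k := k) _).1 h3
    have hX := OrthSplit.Sol_inj hk hq _ hs (fun i j hj => by
      have : j = l := Fin.ext (by omega)
      rw [this]
      exact congrFun h0 i)
    rw [hX] at hf
    apply Subtype.ext
    show Z = 0
    rw [hf]
    simp [OrthSplit.sg]
  have hsurj : Function.Surjective (L.domRestrict S) := by
    rw [← LinearMap.range_eq_top]
    apply OrthSplit.range_top hk hq l hl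
    intro X hX
    refine ⟨⟨Matrix.fromBlocks 0 X (OrthSplit.sg X) 0, (hmem _).2
      ⟨⟨OrthSplit.e_orth X, OrthSplit.e_theta X _⟩, (OrthSplit.e_comm (k := k) _).2 hX⟩⟩, rfl⟩
  rw [(LinearEquiv.ofBijective (L.domRestrict S) ⟨hinj, hsurj⟩).finrank_eq]
  simp [hq]
end

section
/- Let p = q = 2k+1 be odd, n = 2q, F a field of characteristic zero, J_q the q×q antidiagonal identity, J_{q,q} = diag(J_q, −J_q), 𝔤 = 𝔬(J_{q,q}), 𝔤(−1) the −1 eigenspace of conjugation by I_{q,q}. Let e* = [[ε_{k+1}, λ_{k+1,k}],[0_{k,k+1}, 1_k]] and e = [[0, e*],[J_q (e*)ᵗ J_q, 0]]. Then e ∈ 𝔤(−1), e is nilpotent, and dim_F {X ∈ 𝔤(−1) : [e,X] = 0} = 2k+1. -/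
open Matrix

namespace OddSplit

variable {F : Type*} [Field F]

/-- antidiagonal identity -/
def J (F : Type*) [Field F] (q : ℕ) : Matrix (Fin q) (Fin q) F :=
  fun i j => if (i : ℕ) + (j : ℕ) + 1 = q then 1 else 0

/-- the matrix e* -/
def E (F : Type*) [Field F] (k q : ℕ) : Matrix (Fin q) (Fin q) F := fun i j =>
  if (i : ℕ) < k + 1 then (if (j : ℕ) = (i : ℕ) + 1 then 1 else 0)
  else (if (j : ℕ) = (i : ℕ) then 1 else 0)

/-- reflection in the antidiagonal -/
def S {q : ℕ} (A : Matrix (Fin q) (Fin q) F) : Matrix (Fin q) (Fin q) F :=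
  J F q * Aᵀ * J F q

lemma J_apply {q : ℕ} (i j : Fin q) : J F q i j = if j = i.rev then 1 else 0 := by
  unfold J
  congr 1
  simp only [Fin.ext_iff, Fin.val_rev, eq_iff_iff]
  omega

lemma J_apply_right {q : ℕ} (i j : Fin q) : J F q i j = if i = j.rev then 1 else 0 := by
  unfold J
  congr 1
  simp only [Fin.ext_iff, Fin.val_rev, eq_iff_iff]
  omega

lemma J_T {q : ℕ} : (J F q)ᵀ = J F q := by
  ext i j
  rw [transpose_apply, J_apply, J_apply_right]

lemma J_mul_apply {q : ℕ} (A : Matrix (Fin q) (Fin q) F) (i j : Fin q) :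
    (J F q * A) i j = A i.rev j := by
  simp [Matrix.mul_apply, J_apply]

lemma mul_J_apply {q : ℕ} (A : Matrix (Fin q) (Fin q) F) (i j : Fin q) :
    (A * J F q) i j = A i j.rev := by
  simp [Matrix.mul_apply, J_apply_right]

lemma J_J {q : ℕ} : J F q * J F q = 1 := by
  ext i j
  rw [J_mul_apply, J_apply, Matrix.one_apply]
  simp [eq_comm]

lemma S_apply {q : ℕ} (A : Matrix (Fin q) (Fin q) F) (i j : Fin q) :
    S A i j = A j.rev i.rev := by
  rw [S, mul_J_apply, J_mul_apply, transpose_apply]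

lemma S_S {q : ℕ} (A : Matrix (Fin q) (Fin q) F) : S (S A) = A := by
  ext i j
  simp [S_apply]

lemma S_mul {q : ℕ} (A B : Matrix (Fin q) (Fin q) F) : S (A * B) = S B * S A := by
  simp only [S, transpose_mul]
  calc _ = J F q * Bᵀ * 1 * Aᵀ * J F q := by simp [Matrix.mul_assoc]
    _ = _ := by rw [← J_J]; simp [Matrix.mul_assoc]

lemma S_sub {q : ℕ} (A B : Matrix (Fin q) (Fin q) F) : S (A - B) = S A - S B := by
  ext i j
  simp [S_apply]

lemma skew_zero {q : ℕ} [CharZero F] (D : Matrix (Fin q) (Fin q) F) (h : S D = -D)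
    (h0 : ∀ i j : Fin q, i < j → D i j.rev = 0 ∨ D j i.rev = 0) : D = 0 := by
  have key : ∀ i j : Fin q, D j i.rev = - D i j.rev := by
    intro i j
    have := congrFun (congrFun h i) j.rev
    simpa [S_apply] using this
  have : ∀ i j : Fin q, D i j.rev = 0 := by
    intro i j
    rcases lt_trichotomy i j with hl | rfl | hl
    · rcases h0 i j hl with h1 | h1
      · exact h1
      · rw [key] at h1; simpa using h1
    · have := key i i
      exact self_eq_neg.mp this
    · rcases h0 j i hl with h1 | h1
      · rw [key i j] at h1; simpa using h1
      · exact h1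
  ext i j
  have := this i j.rev
  simpa using this

/-- linear version of S -/
def SL (F : Type*) [Field F] (q : ℕ) :
    Matrix (Fin q) (Fin q) F →ₗ[F] Matrix (Fin q) (Fin q) F where
  toFun := S
  map_add' A B := by ext i j; simp [S_apply]
  map_smul' c A := by ext i j; simp [S_apply]

/-- the two commutator blocks -/
def D1 (k q : ℕ) : Matrix (Fin q) (Fin q) F →ₗ[F] Matrix (Fin q) (Fin q) F :=
  (LinearMap.mulLeft F (E F k q)).comp (SL F q) - LinearMap.mulRight F (S (E F k q))

/-- the second block -/
def D2 (k q : ℕ) : Matrix (Fin q) (Fin q) F →ₗ[F] Matrix (Fin q) (Fin q) F :=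
  LinearMap.mulLeft F (S (E F k q)) - (LinearMap.mulRight F (E F k q)).comp (SL F q)

lemma D1_apply (k q : ℕ) (B : Matrix (Fin q) (Fin q) F) :
    D1 k q B = E F k q * S B - B * S (E F k q) := rfl

lemma D2_apply (k q : ℕ) (B : Matrix (Fin q) (Fin q) F) :
    D2 k q B = S (E F k q) * B - S B * E F k q := rfl

/-- independent coordinates of the commutator -/
def Psi (k q : ℕ) : Matrix (Fin q) (Fin q) F →ₗ[F]
    ((Finset.univ : Finset (Fin q)).offDiag → F) where
  toFun B := fun p => if p.1.1 < p.1.2 then D1 k q B p.1.1 p.1.2.rev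
    else D2 k q B p.1.1 p.1.2.rev
  map_add' A B := by
    ext p
    by_cases h : p.1.1 < p.1.2 <;> simp [h]
  map_smul' c A := by
    ext p
    by_cases h : p.1.1 < p.1.2 <;> simp [h]

lemma Psi_ker [CharZero F] (k q : ℕ) (B : Matrix (Fin q) (Fin q) F) (h : Psi k q B = 0) :
    D1 k q B = 0 ∧ D2 k q B = 0 := by
  constructor
  · apply skew_zero
    · rw [D1_apply, S_sub, S_mul, S_mul, S_S, S_S]; simp
    · intro i j hij
      left
      have := congrFun h ⟨(i, j), by simp [hij.ne]⟩
      simpa [Psi, hij] using this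
  · apply skew_zero
    · rw [D2_apply, S_sub, S_mul, S_mul, S_S, S_S]; simp
    · intro i j hij
      right
      have := congrFun h ⟨(j, i), by simp [hij.ne']⟩
      simpa [Psi, hij.le, hij.not_gt] using this

lemma finrank_ker_Psi (k q : ℕ) : q ≤ Module.finrank F (LinearMap.ker (Psi (F := F) k q)) := by
  have h1 := LinearMap.finrank_range_add_finrank_ker (Psi (F := F) k q)
  have h2 := Submodule.finrank_le (LinearMap.range (Psi (F := F) k q))
  rw [Module.finrank_fintype_fun_eq_card, Fintype.card_coe, Finset.offDiag_card] at h2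
  rw [Module.finrank_matrix] at h1
  simp at h1 h2
  have : q ≤ q * q := Nat.le_mul_self q
  omega

/-- blocks of e -/
lemma SE_apply (k : ℕ) (i j : Fin (2 * k + 1)) : S (E F k (2 * k + 1)) i j =
    if k ≤ (j : ℕ) then (if (j : ℕ) = (i : ℕ) + 1 then 1 else 0)
      else (if (j : ℕ) = (i : ℕ) then 1 else 0) := by
  rw [S_apply]
  unfold E
  have hi := i.2
  have hj := j.2
  simp only [Fin.val_rev]
  split_ifs <;> first | rfl | omega

lemma nilp_of_weight {n : Type*} [Fintype n] [DecidableEq n] (M : Matrix n n F) (wt : n → ℕ)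
    (h : ∀ i j, M i j ≠ 0 → wt i < wt j) : IsNilpotent M := by
  have key : ∀ m : ℕ, ∀ i j, (M ^ m) i j ≠ 0 → wt i + m ≤ wt j := by
    intro m
    induction m with
    | zero =>
      intro i j hij
      by_cases hh : i = j
      · simp [hh]
      · simp [hh] at hij
    | succ m ih =>
      intro i j hij
      rw [pow_succ, Matrix.mul_apply] at hij
      obtain ⟨l, _, hl⟩ := Finset.exists_ne_zero_of_sum_ne_zero hij
      have h1 := ih i l (left_ne_zero_of_mul hl)
      have h2 := h l j (right_ne_zero_of_mul hl)
      omega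
  refine ⟨Finset.univ.sup wt + 1, ?_⟩
  ext i j
  by_contra hne
  have h1 := key _ i j hne
  have h2 : wt j ≤ Finset.univ.sup wt := Finset.le_sup (Finset.mem_univ j)
  omega

lemma e_nilp (k : ℕ) : IsNilpotent
    (Matrix.fromBlocks 0 (E F k (2 * k + 1)) (S (E F k (2 * k + 1))) 0) := by
  apply nilp_of_weight _ (Sum.elim
    (fun j : Fin (2 * k + 1) => if (j : ℕ) < k then 4 * (j : ℕ) + 2 else 4 * (j : ℕ) - 1)
    (fun j : Fin (2 * k + 1) => 4 * (j : ℕ)))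
  rintro (i | i) (j | j) h
  · simp at h
  · simp only [fromBlocks_apply₁₂, E] at h
    have hi := i.2
    have hj := j.2
    simp only [Sum.elim_inl, Sum.elim_inr]
    split_ifs at h ⊢ <;> first | omega | simp at h
  · simp only [fromBlocks_apply₂₁, SE_apply] at h
    have hi := i.2
    have hj := j.2
    simp only [Sum.elim_inl, Sum.elim_inr]
    split_ifs at h ⊢ <;> first | omega | simp at h
  · simp at h

/-- columns of a product with e star -/
lemma col_E (k : ℕ) (A : Matrix (Fin (2 * k + 1)) (Fin (2 * k + 1)) F)
    (r : Fin (2 * k + 1)) (j : ℕ) (hj : j + 1 < 2 * k + 1) :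
    (A * E F k (2 * k + 1)) r ⟨j + 1, hj⟩ =
      (if j ≤ k then A r ⟨j, by omega⟩ else 0) + (if k ≤ j then A r ⟨j + 1, hj⟩ else 0) := by
  rw [Matrix.mul_apply]
  have : ∀ x : Fin (2 * k + 1), A r x * E F k (2 * k + 1) x ⟨j + 1, hj⟩ =
      (if x = ⟨j, by omega⟩ then (if j ≤ k then A r x else 0) else 0) +
      (if x = ⟨j + 1, hj⟩ then (if k ≤ j then A r x else 0) else 0) := by
    intro x
    simp only [E, Fin.ext_iff]
    split_ifs <;> first | omega | simp
  simp only [this, Finset.sum_add_distrib, Finset.sum_ite_eq', Finset.mem_univ, if_true]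

lemma col_SE_lt (k : ℕ) (A : Matrix (Fin (2 * k + 1)) (Fin (2 * k + 1)) F)
    (r : Fin (2 * k + 1)) (j : ℕ) (hj : j < k) :
    (A * S (E F k (2 * k + 1))) r ⟨j, by omega⟩ = A r ⟨j, by omega⟩ := by
  rw [Matrix.mul_apply]
  have : ∀ x : Fin (2 * k + 1), A r x * S (E F k (2 * k + 1)) x ⟨j, by omega⟩ =
      (if x = ⟨j, by omega⟩ then A r x else 0) := by
    intro x
    simp only [SE_apply, Fin.ext_iff]
    split_ifs <;> first | omega | simp
  simp only [this, Finset.sum_ite_eq', Finset.mem_univ, if_true]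

lemma col_SE_ge (k : ℕ) (A : Matrix (Fin (2 * k + 1)) (Fin (2 * k + 1)) F)
    (r : Fin (2 * k + 1)) (j : ℕ) (hj : k ≤ j + 1) (hj2 : j + 1 < 2 * k + 1) :
    (A * S (E F k (2 * k + 1))) r ⟨j + 1, hj2⟩ = A r ⟨j, by omega⟩ := by
  rw [Matrix.mul_apply]
  have : ∀ x : Fin (2 * k + 1), A r x * S (E F k (2 * k + 1)) x ⟨j + 1, hj2⟩ =
      (if x = ⟨j, by omega⟩ then A r x else 0) := by
    intro x
    simp only [SE_apply, Fin.ext_iff]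
    split_ifs <;> first | omega | simp
  simp only [this, Finset.sum_ite_eq', Finset.mem_univ, if_true]

/-- column j of the triple product away from the middle -/
lemma col_N (k : ℕ) (A : Matrix (Fin (2 * k + 1)) (Fin (2 * k + 1)) F)
    (r : Fin (2 * k + 1)) (j : ℕ) (hj : j + 1 < 2 * k + 1) (hjk : j ≠ k) :
    (A * S (E F k (2 * k + 1)) * E F k (2 * k + 1)) r ⟨j + 1, hj⟩ = A r ⟨j, by omega⟩ := by
  rw [col_E]
  rcases lt_or_gt_of_ne hjk with h | h
  · rw [if_pos h.le, if_neg (by omega), col_SE_lt k A r j h, add_zero]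
  · rw [if_neg (by omega), if_pos h.le, col_SE_ge k A r j (by omega) hj, zero_add]

lemma col_N_mid (m : ℕ) (A : Matrix (Fin (2 * (m + 1) + 1)) (Fin (2 * (m + 1) + 1)) F)
    (r : Fin (2 * (m + 1) + 1)) :
    (A * S (E F (m + 1) (2 * (m + 1) + 1)) * E F (m + 1) (2 * (m + 1) + 1)) r
      ⟨m + 1 + 1, by omega⟩ = A r ⟨m, by omega⟩ + A r ⟨m + 1, by omega⟩ := by
  rw [col_E, if_pos le_rfl, if_pos le_rfl, col_SE_ge _ A r m (by omega),
    col_SE_ge _ A r (m + 1) (by omega)]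

lemma B_zero (k : ℕ) (B G : Matrix (Fin (2 * k + 1)) (Fin (2 * k + 1)) F)
    (hG : B * S (E F k (2 * k + 1)) * E F k (2 * k + 1) = G * B)
    (hB : ∀ r, B r (Fin.last _) = 0) : B = 0 := by
  -- upper half
  have hup : ∀ d : ℕ, d < 2 * k + 1 → ∀ j (hj : j < 2 * k + 1), j + d = 2 * k → k < j →
      ∀ r, B r ⟨j, hj⟩ = 0 := by
    intro d
    induction d with
    | zero =>
      intro _ j hj h1 h2 r
      have : (⟨j, hj⟩ : Fin (2 * k + 1)) = Fin.last _ := by ext; simp; omega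
      rw [this, hB]
    | succ d ih =>
      intro hd j hj h1 h2 r
      have h3 := ih (by omega) (j + 1) (by omega) (by omega) (by omega)
      rw [← col_N k B r j (by omega) (by omega), hG, Matrix.mul_apply]
      simp [h3]
  rcases k with _ | m
  · ext r j
    have : j = Fin.last _ := by ext; simp
    rw [this, hB]; rfl
  -- sums of adjacent columns vanish
  have hmid : ∀ d : ℕ, ∀ j (hj : j + 1 < 2 * (m + 1) + 1), j + d = m →
      ∀ r, B r ⟨j, by omega⟩ + B r ⟨j + 1, hj⟩ = 0 := by
    intro d
    induction d with
    | zero =>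
      intro j hj h1 r
      obtain rfl : j = m := by omega
      have h3 := hup j (by omega) (j + 1 + 1) (by omega) (by omega) (by omega)
      rw [← col_N_mid, hG, Matrix.mul_apply]
      simp [h3]
    | succ d ih =>
      intro j hj h1 r
      have h3 := ih (j + 1) (by omega) (by omega)
      rw [← col_N (m + 1) B r j (by omega) (by omega),
        ← col_N (m + 1) B r (j + 1) (by omega) (by omega), hG, Matrix.mul_apply,
        Matrix.mul_apply, ← Finset.sum_add_distrib]
      apply Finset.sum_eq_zero
      intro x _
      rw [← mul_add, h3, mul_zero]
  have hcol0 : ∀ x, (G * B) x ⟨0, by omega⟩ = 0 := by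
    intro x
    rw [← hG, Matrix.mul_apply]
    apply Finset.sum_eq_zero
    intro y _
    simp [E]
    intro h1 h2
    omega
  have h0 : ∀ r, B r ⟨0, by omega⟩ = 0 := by
    intro r
    have h3 := hmid m 0 (by omega) (by omega)
    have h4 := hcol0 r
    rw [← col_N (m + 1) B r 0 (by omega) (by omega), hG]
    have h5 : (G * B) r ⟨0, by omega⟩ + (G * B) r ⟨0 + 1, by omega⟩ = 0 := by
      rw [Matrix.mul_apply, Matrix.mul_apply, ← Finset.sum_add_distrib]
      apply Finset.sum_eq_zero
      intro x _
      rw [← mul_add, h3, mul_zero]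
    rwa [h4, zero_add] at h5
  have hlow : ∀ j (hj : j < 2 * (m + 1) + 1), j ≤ m + 1 → ∀ r, B r ⟨j, hj⟩ = 0 := by
    intro j
    induction j with
    | zero => intro _ _ r; exact h0 r
    | succ j ih =>
      intro hj h1 r
      have h3 := hmid (m - j) j hj (by omega) r
      rwa [ih (by omega) (by omega), zero_add] at h3
  ext r j
  rcases le_or_gt (j : ℕ) (m + 1) with h | h
  · exact hlow j j.2 h r
  · exact hup (2 * (m + 1) - j) (by omega) j j.2 (by omega) h r

/-- the embedding of the blocks into 𝔤(−1) -/
def iota (q : ℕ) : Matrix (Fin q) (Fin q) F →ₗ[F]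
    Matrix (Fin q ⊕ Fin q) (Fin q ⊕ Fin q) F where
  toFun B := fromBlocks 0 B (S B) 0
  map_add' A B := by
    have := (SL F q).map_add A B
    change S (A + B) = S A + S B at this
    simp [fromBlocks_add, this]
  map_smul' c A := by
    have := (SL F q).map_smul c A
    change S (c • A) = c • S A at this
    simp [fromBlocks_smul, this]

lemma iota_inj (q : ℕ) : Function.Injective (iota (F := F) q) := by
  intro A B h
  exact (fromBlocks_inj.mp h).2.1

lemma orth_iff {q : ℕ} (B C : Matrix (Fin q) (Fin q) F) :
    (fromBlocks 0 B C 0)ᵀ * fromBlocks (J F q) 0 0 (-J F q) +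
      fromBlocks (J F q) 0 0 (-J F q) * fromBlocks 0 B C 0 = 0 ↔ C = S B := by
  rw [fromBlocks_transpose, fromBlocks_multiply, fromBlocks_multiply, fromBlocks_add,
    ← fromBlocks_zero, fromBlocks_inj]
  simp only [transpose_zero, zero_mul, mul_zero, add_zero, zero_add, true_and, and_true, mul_neg,
    neg_mul, neg_zero]
  constructor
  · rintro ⟨_, h⟩
    have h : Bᵀ * J F q = J F q * C := by
      rwa [← sub_eq_add_neg, sub_eq_zero] at h
    rw [S, Matrix.mul_assoc, h, ← Matrix.mul_assoc, J_J, Matrix.one_mul]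
  · rintro rfl
    constructor
    · simp only [S, transpose_mul, J_T, transpose_transpose]
      simp [Matrix.mul_assoc, J_J]
    · rw [S, ← Matrix.mul_assoc, ← Matrix.mul_assoc, J_J, Matrix.one_mul]
      simp

lemma theta_iff [CharZero F] {q : ℕ} (A B C D : Matrix (Fin q) (Fin q) F) :
    (fromBlocks 1 0 0 (-1) : Matrix (Fin q ⊕ Fin q) (Fin q ⊕ Fin q) F) *
      (fromBlocks A B C D * fromBlocks 1 0 0 (-1)) = (-1 : F) • fromBlocks A B C D ↔
      A = 0 ∧ D = 0 := by
  rw [fromBlocks_multiply, fromBlocks_multiply, fromBlocks_smul, fromBlocks_inj]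
  have hs : ∀ M : Matrix (Fin q) (Fin q) F, M = -M ↔ M = 0 := by
    intro M
    constructor
    · intro h
      ext i j
      exact self_eq_neg.mp (congrFun (congrFun h i) j)
    · rintro rfl
      simp
  simp [hs]

end OddSplit



/-- for p = q = 2k+1, the element e = [[0, e*], [J_q (e*)ᵀ J_q, 0]]
(with e* obtained from the identity by shifting the first k+1 diagonal entries one
column to the right) lies in 𝔤(−1) for 𝔤 = 𝔬(J_{q,q}), is nilpotent, and its
centralizer in 𝔤(−1) has dimension 2k+1. -/
theorem orthogonal_odd_split_centralizer
    (F : Type*) [Field F] [CharZero F] (k q : ℕ) (hq : q = 2 * k + 1) :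
    let n := Fin q ⊕ Fin q
    let Jq : Matrix (Fin q) (Fin q) F := fun i j => if (i : ℕ) + (j : ℕ) + 1 = q then 1 else 0
    let Jqq : Matrix n n F := Matrix.fromBlocks Jq 0 0 (-Jq)
    let Iqq : Matrix n n F := Matrix.fromBlocks 1 0 0 (-1)
    let estar : Matrix (Fin q) (Fin q) F := fun i j =>
      if (i : ℕ) < k + 1 then (if (j : ℕ) = (i : ℕ) + 1 then 1 else 0)
      else (if (j : ℕ) = (i : ℕ) then 1 else 0)
    let e : Matrix n n F := Matrix.fromBlocks 0 estar (Jq * estarᵀ * Jq) 0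
    let orth : Matrix n n F →ₗ[F] Matrix n n F :=
      (LinearMap.mulRight F Jqq).comp
        (Matrix.transposeLinearEquiv n n F F).toLinearMap + LinearMap.mulLeft F Jqq
    let θ : Module.End F (Matrix n n F) :=
      (LinearMap.mulLeft F Iqq).comp (LinearMap.mulRight F Iqq)
    let ade : Module.End F (Matrix n n F) :=
      LinearMap.mulLeft F e - LinearMap.mulRight F e
    (eᵀ * Jqq + Jqq * e = 0) ∧ (Iqq * e * Iqq = -e) ∧ IsNilpotent e ∧
    Module.finrank F
      ↥(LinearMap.ker orth ⊓ Module.End.eigenspace θ (-1) ⊓ LinearMap.ker ade) = 2 * k + 1 := by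
  subst hq
  intro n Jq Jqq Iqq estar e orth θ ade
  have he : e = fromBlocks 0 (OddSplit.E F k (2 * k + 1)) (OddSplit.S (OddSplit.E F k (2 * k + 1))) 0 := rfl
  have hJ : Jqq = fromBlocks (OddSplit.J F (2 * k + 1)) 0 0 (-OddSplit.J F (2 * k + 1)) := rfl
  have hmem : ∀ X, X ∈ LinearMap.ker orth ⊓ Module.End.eigenspace θ (-1) ⊓ LinearMap.ker ade ↔
      (Xᵀ * Jqq + Jqq * X = 0 ∧ Iqq * (X * Iqq) = (-1 : F) • X) ∧ e * X - X * e = 0 := by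
    intro X
    rw [Submodule.mem_inf, Submodule.mem_inf, Module.End.mem_eigenspace_iff]
    rfl
  have hcomm : ∀ B, e * OddSplit.iota (F := F) (2 * k + 1) B -
      OddSplit.iota (F := F) (2 * k + 1) B * e = 0 ↔
      OddSplit.D1 k (2 * k + 1) B = 0 ∧ OddSplit.D2 k (2 * k + 1) B = 0 := by
    intro B
    change e * fromBlocks 0 B (OddSplit.S B) 0 - fromBlocks 0 B (OddSplit.S B) 0 * e = 0 ↔ _
    rw [he, sub_eq_zero, fromBlocks_multiply, fromBlocks_multiply, fromBlocks_inj,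
      OddSplit.D1_apply, OddSplit.D2_apply, sub_eq_zero, sub_eq_zero]
    simp
  refine ⟨?_, ?_, ?_, ?_⟩
  · rw [he, hJ, OddSplit.orth_iff]
  · rw [Matrix.mul_assoc, he]
    have := (OddSplit.theta_iff (F := F) 0 (OddSplit.E F k (2 * k + 1))
      (OddSplit.S (OddSplit.E F k (2 * k + 1))) 0).mpr ⟨rfl, rfl⟩
    rwa [neg_one_smul] at this
  · rw [he]; exact OddSplit.e_nilp k
  · apply le_antisymm
    · let φ : Matrix n n F →ₗ[F] (Fin (2 * k + 1) → F) :=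
        { toFun := fun X i => X (Sum.inl i) (Sum.inr (Fin.last _))
          map_add' := fun _ _ => rfl
          map_smul' := fun _ _ => rfl }
      let W := LinearMap.ker orth ⊓ Module.End.eigenspace θ (-1) ⊓ LinearMap.ker ade
      have hinj : Function.Injective (φ.comp W.subtype) := by
        rw [injective_iff_map_eq_zero]
        rintro ⟨X, hX⟩ h
        obtain ⟨⟨h1, h2⟩, h3⟩ := (hmem X).mp hX
        have hφ : ∀ r, X (Sum.inl r) (Sum.inr (Fin.last _)) = 0 := fun r => congrFun h r
        obtain ⟨A, B, C, D, rfl⟩ : ∃ A B C D, X = fromBlocks A B C D :=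
          ⟨_, _, _, _, (fromBlocks_toBlocks X).symm⟩
        obtain ⟨rfl, rfl⟩ := (OddSplit.theta_iff A B C D).mp h2
        obtain rfl := (OddSplit.orth_iff B C).mp h1
        obtain ⟨h4, h5⟩ := (hcomm B).mp h3
        rw [OddSplit.D1_apply, sub_eq_zero] at h4
        rw [OddSplit.D2_apply, sub_eq_zero] at h5
        have hB : B = 0 := by
          apply OddSplit.B_zero k B
            (OddSplit.E F k (2 * k + 1) * OddSplit.S (OddSplit.E F k (2 * k + 1)))
          · rw [← h4, Matrix.mul_assoc, ← h5, Matrix.mul_assoc]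
          · exact hφ
        subst hB
        exact Subtype.ext ((OddSplit.iota (F := F) (2 * k + 1)).map_zero)
      have := LinearMap.finrank_le_finrank_of_injective hinj
      simpa using this
    · have hle : (LinearMap.ker (OddSplit.Psi (F := F) k (2 * k + 1))).map
          (OddSplit.iota (F := F) (2 * k + 1)) ≤
          LinearMap.ker orth ⊓ Module.End.eigenspace θ (-1) ⊓ LinearMap.ker ade := by
        rintro _ ⟨B, hB, rfl⟩
        rw [hmem]
        refine ⟨⟨(OddSplit.orth_iff B _).mpr rfl, (OddSplit.theta_iff 0 B _ 0).mpr ⟨rfl, rfl⟩⟩,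
          (hcomm B).mpr (OddSplit.Psi_ker k _ B hB)⟩
      have h1 := Submodule.finrank_mono hle
      rw [← LinearEquiv.finrank_eq (Submodule.equivMapOfInjective _
        (OddSplit.iota_inj (F := F) (2 * k + 1)) _)] at h1
      exact (OddSplit.finrank_ker_Psi k _).trans h1
end
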